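/- (Sturm comparison theorem II) Let l > 0 and, for i = 1, 2, let b_i : [0, l] → ℝ be continuous and f_i : [0, l] → ℝ be twice continuously differentiable with f_i(0) = 0, f_i'(0) = 1, satisfying f_i'' + b_i f_i = 0 on [0, l]. Suppose b_1(x) ≥ b_2(x) for all x ∈ [0, l] and f_1 > 0 on (0, l). Then f_1(x) ≤ f_2(x) for all x ∈ (0, l); and if f_1(t_1) = f_2(t_1) for some t_1 ∈ (0, l), then b_1 ≡ b_2 on [0, t_1]. -/

import Mathlib

open Set

open Filter Topology

/-- The first-order terms cancel in the derivative of the Wronskian of two functions. -/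
theorem hasDerivAt_wronskian {f g : ℝ → ℝ} (hf : ContDiff ℝ 2 f) (hg : ContDiff ℝ 2 g) (x : ℝ) :
    HasDerivAt (fun y => deriv f y * g y - f y * deriv g y)
      (deriv (deriv f) x * g x - f x * deriv (deriv g) x) x := by
  have h (u : ℝ → ℝ) (hu : ContDiff ℝ 2 u) :
      HasDerivAt u (deriv u x) x ∧ HasDerivAt (deriv u) (deriv (deriv u) x) x :=
    ⟨(hu.differentiable (by norm_num) x).hasDerivAt,
      ((hu.deriv' (n := 1)).differentiable (by norm_num) x).hasDerivAt⟩
  obtain ⟨hf₁, hf₂⟩ := h f hf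
  obtain ⟨hg₁, hg₂⟩ := h g hg
  refine ((hf₂.mul hg₁).sub (hf₁.mul hg₂)).congr_deriv ?_
  ring

theorem tendsto_div_self_of_deriv_eq_one {f : ℝ → ℝ} (hf : DifferentiableAt ℝ f 0) (h0 : f 0 = 0)
    (h1 : deriv f 0 = 1) : Tendsto (fun x => f x / x) (𝓝[>] 0) (𝓝 1) := by
  have h := hf.hasDerivAt
  rw [h1, hasDerivAt_iff_tendsto_slope] at h
  refine (h.mono_left (nhdsWithin_mono 0 fun x hx => ne_of_gt hx)).congr fun x => ?_
  simp [slope_def_field, h0]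

/-- If `g > 0` on `(0, t]`, both functions vanish at `0` with derivative `1`, and
their Wronskian has nonnegative derivative on `(0, t)`, then `f / g` is monotone and
 at least `1` on `(0, t]`. -/
theorem monotoneOn_div_and_one_le_div {f g : ℝ → ℝ} {t : ℝ} (hf : ContDiff ℝ 2 f)
    (hg : ContDiff ℝ 2 g) (hf0 : f 0 = 0) (hg0 : g 0 = 0) (hfd : deriv f 0 = 1)
    (hgd : deriv g 0 = 1) (hpos : ∀ x ∈ Ioc 0 t, 0 < g x)
    (hW : ∀ x ∈ Ioo 0 t, f x * deriv (deriv g) x ≤ deriv (deriv f) x * g x) :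
    MonotoneOn (fun x => f x / g x) (Ioc 0 t) ∧ ∀ x ∈ Ioc 0 t, 1 ≤ f x / g x := by
  have hdf : Differentiable ℝ f := hf.differentiable (by norm_num)
  have hdg : Differentiable ℝ g := hg.differentiable (by norm_num)
  have hWmono : MonotoneOn (fun y => deriv f y * g y - f y * deriv g y) (Icc 0 t) := by
    refine monotoneOn_of_deriv_nonneg (convex_Icc 0 t)
      (fun x _ => (hasDerivAt_wronskian hf hg x).continuousAt.continuousWithinAt)
      (fun x _ => (hasDerivAt_wronskian hf hg x).differentiableAt.differentiableWithinAt)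
      fun x hx => ?_
    rw [interior_Icc] at hx
    rw [(hasDerivAt_wronskian hf hg x).deriv]
    exact sub_nonneg.2 (hW x hx)
  have hWnonneg : ∀ x ∈ Ioc 0 t, 0 ≤ deriv f x * g x - f x * deriv g x := fun x hx => by
    simpa [hf0, hg0] using
      hWmono (left_mem_Icc.2 (hx.1.le.trans hx.2)) (Ioc_subset_Icc_self hx) hx.1.le
  have hq : ∀ x ∈ Ioc 0 t, HasDerivAt (fun y => f y / g y)
      ((deriv f x * g x - f x * deriv g x) / g x ^ 2) x := fun x hx =>
    (hdf x).hasDerivAt.div (hdg x).hasDerivAt (hpos x hx).ne'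
  have hmono : MonotoneOn (fun x => f x / g x) (Ioc 0 t) := by
    refine monotoneOn_of_deriv_nonneg (convex_Ioc 0 t)
      (fun x hx => (hq x hx).continuousAt.continuousWithinAt)
      (fun x hx => (hq x (interior_subset hx)).differentiableAt.differentiableWithinAt)
      fun x hx => ?_
    rw [(hq x (interior_subset hx)).deriv]
    exact div_nonneg (hWnonneg x (interior_subset hx)) (sq_nonneg _)
  refine ⟨hmono, fun x hx => ?_⟩
  have hlim : Tendsto (fun y => f y / g y) (𝓝[>] 0) (𝓝 1) := by
    have h := (tendsto_div_self_of_deriv_eq_one (hdf 0) hf0 hfd).div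
      (tendsto_div_self_of_deriv_eq_one (hdg 0) hg0 hgd) one_ne_zero
    rw [div_one] at h
    refine h.congr' ?_
    filter_upwards [self_mem_nhdsWithin] with y hy
    exact div_div_div_cancel_right₀ (ne_of_gt hy) _ _
  refine le_of_tendsto hlim ?_
  filter_upwards [Ioc_mem_nhdsGT hx.1] with y hy
  exact hmono ⟨hy.1, hy.2.trans hx.2⟩ hx hy.2

theorem sturm_comparison_II
    (l : ℝ) (hl : 0 < l)
    (b1 b2 : ℝ → ℝ)
    (hb1c : ContinuousOn b1 (Icc 0 l)) (hb2c : ContinuousOn b2 (Icc 0 l))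
    (f1 f2 : ℝ → ℝ) (hf1 : ContDiff ℝ 2 f1) (hf2 : ContDiff ℝ 2 f2)
    (hf10 : f1 0 = 0) (hf1d : deriv f1 0 = 1)
    (hf20 : f2 0 = 0) (hf2d : deriv f2 0 = 1)
    (hode1 : ∀ x ∈ Icc 0 l, deriv (deriv f1) x + b1 x * f1 x = 0)
    (hode2 : ∀ x ∈ Icc 0 l, deriv (deriv f2) x + b2 x * f2 x = 0)
    (hb : ∀ x ∈ Icc 0 l, b2 x ≤ b1 x)
    (hf1pos : ∀ x ∈ Ioo 0 l, 0 < f1 x) :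
    (∀ x ∈ Ioo 0 l, f1 x ≤ f2 x) ∧
      (∀ t1 ∈ Ioo 0 l, f1 t1 = f2 t1 → ∀ x ∈ Icc 0 t1, b1 x = b2 x) := by
  have key : ∀ t ∈ Ioo 0 l, (∀ x ∈ Ioo 0 t, 0 ≤ f2 x) →
      MonotoneOn (fun x => f2 x / f1 x) (Ioc 0 t) ∧ ∀ x ∈ Ioc 0 t, 1 ≤ f2 x / f1 x := by
    intro t ht hnn
    refine monotoneOn_div_and_one_le_div hf2 hf1 hf20 hf10 hf2d hf1d
      (fun x hx => hf1pos x ⟨hx.1, hx.2.trans_lt ht.2⟩) fun x hx => ?_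
    have hxl : x ∈ Ioo 0 l := ⟨hx.1, hx.2.trans ht.2⟩
    have hx' : x ∈ Icc 0 l := Ioo_subset_Icc_self hxl
    rw [eq_neg_of_add_eq_zero_left (hode1 x hx'), eq_neg_of_add_eq_zero_left (hode2 x hx')]
    nlinarith [mul_nonneg (mul_nonneg (sub_nonneg.2 (hb x hx')) (hf1pos x hxl).le) (hnn x hx)]
  have hpos : ∀ x ∈ Ioo 0 l, 0 < f2 x := by
    by_contra! ⟨x, hx, hfx⟩
    have hnear : ∀ᶠ y in 𝓝[>] (0 : ℝ), 0 < f2 y := by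
      filter_upwards [(tendsto_div_self_of_deriv_eq_one
        (hf2.differentiable (by norm_num) 0) hf20 hf2d).eventually (lt_mem_nhds one_pos),
        self_mem_nhdsWithin] with y hy hy0
      exact (div_pos_iff_of_pos_right hy0).1 hy
    obtain ⟨δ, hδ, hδpos⟩ := mem_nhdsGT_iff_exists_Ioo_subset.1 hnear
    have hδx : δ ≤ x := not_lt.1 fun h => hfx.not_gt (hδpos ⟨hx.1, h⟩)
    obtain ⟨c, ⟨⟨hδc, hcx⟩, hfc⟩, hmin⟩ :=
      (isCompact_Icc.inter_right (isClosed_le hf2.continuous continuous_const) :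
        IsCompact (Icc δ x ∩ {y | f2 y ≤ 0})).exists_isLeast ⟨x, ⟨hδx, le_rfl⟩, hfx⟩
    have hc : c ∈ Ioo 0 l := ⟨lt_of_lt_of_le hδ hδc, hcx.trans_lt hx.2⟩
    have hnn : ∀ y ∈ Ioo 0 c, 0 ≤ f2 y := by
      intro y hy
      by_contra! hneg
      rcases lt_or_ge y δ with h | h
      · exact hneg.not_gt (hδpos ⟨hy.1, h⟩)
      · exact hy.2.not_ge (hmin ⟨⟨h, hy.2.le.trans hcx⟩, hneg.le⟩)
    have h1 := (one_le_div (hf1pos c hc)).1 ((key c hc hnn).2 c ⟨hc.1, le_rfl⟩)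
    exact ((hf1pos c hc).trans_le h1).not_ge hfc
  have key' : ∀ t ∈ Ioo 0 l,
      MonotoneOn (fun x => f2 x / f1 x) (Ioc 0 t) ∧ ∀ x ∈ Ioc 0 t, 1 ≤ f2 x / f1 x :=
    fun t ht => key t ht fun x hx => (hpos x ⟨hx.1, hx.2.trans ht.2⟩).le
  refine ⟨fun x hx => (one_le_div (hf1pos x hx)).1 ((key' x hx).2 x ⟨hx.1, le_rfl⟩),
    fun t ht heq => ?_⟩
  have hsub : Icc 0 t ⊆ Icc 0 l := Icc_subset_Icc_right ht.2.le
  have hf : EqOn f1 f2 (Ioo 0 t) := by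
    intro x hx
    have hx' : x ∈ Ioc 0 t := Ioo_subset_Ioc_self hx
    have hle : f2 x / f1 x ≤ f2 t / f1 t := (key' t ht).1 hx' ⟨ht.1, le_rfl⟩ hx.2.le
    rw [← heq, div_self (hf1pos t ht).ne'] at hle
    have hfx := hf1pos x ⟨hx.1, hx.2.trans ht.2⟩
    exact ((div_eq_one_iff_eq hfx.ne').1 (hle.antisymm ((key' t ht).2 x hx'))).symm
  have hbeq : EqOn b1 b2 (Ioo 0 t) := by
    intro x hx
    have hx' : x ∈ Icc 0 l := hsub (Ioo_subset_Icc_self hx)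
    have hdd : deriv (deriv f1) x = deriv (deriv f2) x :=
      (hf.eventuallyEq_of_mem (Ioo_mem_nhds hx.1 hx.2)).deriv.deriv_eq
    have h1 := hode1 x hx'
    rw [hdd, hf hx] at h1
    exact mul_right_cancel₀ (hpos x ⟨hx.1, hx.2.trans ht.2⟩).ne'
      (add_left_cancel (h1.trans (hode2 x hx').symm))
  exact hbeq.of_subset_closure (hb1c.mono hsub) (hb2c.mono hsub) Ioo_subset_Icc_self
    (closure_Ioo ht.1.ne).ge
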